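/- Let a < b and F: [a,b] × ℝ² → ℝ be continuous and satisfy: (i) (x,y) ↦ F(x,y,0) has linear growth in y, uniformly in x ∈ [a,b]; (ii) F is non-decreasing in the second variable, i.e. (F(x,y,z) − F(x,ỹ,z))(y − ỹ) ≥ 0 for all x ∈ [a,b], y, ỹ, z ∈ ℝ; (iii) F is globally Lipschitz in the third variable, uniformly in the other variables. Then for every A, B ∈ ℝ there exists exactly one solution u ∈ C¹([a,b]) of the boundary value problem Lu = F(x,u,u'), u(a) = A, u(b) = B. -/

import Mathlib

open Set MeasureTheory intervalIntegral

/-- A function `u ∈ C¹([a,b])` is a solution of the boundary value problem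
`Lu = F(x,u,u')`, `u(a) = A`, `u(b) = B` for the second order operator `L` with
generalized drift (with data `σ` and `Σ = Sig`) if `u(a) = A`, `u(b) = B` and,
denoting by `d` the derivative of `u` on `[a,b]` (which is continuous), there is
`x₁ ∈ ℝ` such that
`u'(x) = e^{−Σ(x)} (2 ∫_a^x e^{Σ(y)} F(y,u(y),u'(y))/σ²(y) dy + x₁)` on `[a,b]`. -/
def IsBVPSolutionF (σ Sig : ℝ → ℝ) (a b A B : ℝ) (F : ℝ → ℝ → ℝ → ℝ) (u : ℝ → ℝ) :
    Prop :=
  u a = A ∧ u b = B ∧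
  ∃ (d : ℝ → ℝ) (x₁ : ℝ),
    ContinuousOn d (Set.Icc a b) ∧
    (∀ x ∈ Set.Icc a b, HasDerivWithinAt u (d x) (Set.Icc a b) x) ∧
    ∀ x ∈ Set.Icc a b,
      d x = Real.exp (-(Sig x)) *
        (2 * (∫ y in a..x, Real.exp (Sig y) * F y (u y) (d y) / (σ y) ^ 2) + x₁)


structure BSol (p : ℝ → ℝ) (a b A B : ℝ) (G : ℝ → ℝ → ℝ → ℝ) (h u v : ℝ → ℝ) : Prop where
  ua : u a = A
  ub : u b = B
  du : ∀ x ∈ Icc a b, HasDerivWithinAt u (p x * v x) (Icc a b) x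
  dv : ∀ x ∈ Icc a b, HasDerivWithinAt v (G x (u x) (v x) + h x) (Icc a b) x

/-- first zero -/
lemma first_zero {z : ℝ → ℝ} {x b : ℝ} (hz : ContinuousOn z (Icc x b)) (hx : 0 < z x)
    (h : ∃ t ∈ Icc x b, z t ≤ 0) :
    ∃ t ∈ Icc x b, z t ≤ 0 ∧ x < t ∧ ∀ s ∈ Ico x t, 0 < z s := by
  have hc : IsCompact (Icc x b ∩ z ⁻¹' (Iic 0)) :=
    (isCompact_Icc).of_isClosed_subset (hz.preimage_isClosed_of_isClosed isClosed_Icc isClosed_Iic)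
      inter_subset_left
  obtain ⟨t0, h1, h2⟩ := h
  obtain ⟨t, ht, hmin⟩ := hc.exists_isLeast ⟨t0, h1, h2⟩
  refine ⟨t, ht.1, ht.2, lt_of_le_of_ne ht.1.1 ?_, ?_⟩
  · rintro rfl
    exact absurd ht.2 (not_le.2 hx)
  · intro s hs
    by_contra hcon
    have := hmin ⟨⟨hs.1, hs.2.le.trans ht.1.2⟩, not_lt.1 hcon⟩
    exact absurd hs.2 (not_lt.2 this)

lemma stab_right {p w z g : ℝ → ℝ} {a b K ε : ℝ} (hp : ∀ x, 0 < p x) (hK : 0 ≤ K) (hε : 0 ≤ ε)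
    (hw : ∀ x ∈ Icc a b, HasDerivWithinAt w (p x * z x) (Icc a b) x)
    (hz : ∀ x ∈ Icc a b, HasDerivWithinAt z (g x) (Icc a b) x)
    (hg : ∀ x ∈ Icc a b, 0 < w x → 0 < z x → -K * z x - ε ≤ g x)
    (hwb : w b ≤ 0) {x : ℝ} (hx : x ∈ Ico a b) (hwx : 0 ≤ w x) :
    z x ≤ (b - a) * Real.exp (K * (b - a)) * ε := by
  by_contra! hcon
  have hE : 0 < Real.exp (K * (b - a)) := Real.exp_pos _
  have hzx : 0 < z x := lt_of_le_of_lt (by have := hx.1; have := hx.2; have : 0 ≤ b - a := by linarith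
                                           positivity) hcon
  have hsub : Icc x b ⊆ Icc a b := Icc_subset_Icc_left hx.1
  have hzc : ContinuousOn z (Icc a b) := fun y hy => (hz y hy).continuousWithinAt
  have hwc : ContinuousOn w (Icc a b) := fun y hy => (hw y hy).continuousWithinAt
  -- w strictly increasing where z > 0
  have key : ∀ t ∈ Ioc x b, (∀ s ∈ Ico x t, 0 < z s) → 0 < w t := by
    intro t ht hpos
    have : StrictMonoOn w (Icc x t) := by
      refine strictMonoOn_of_deriv_pos (convex_Icc _ _)
        (hwc.mono ((Icc_subset_Icc_right ht.2).trans hsub)) ?_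
      intro s hs
      rw [interior_Icc] at hs
      have hs' : s ∈ Ioo a b := ⟨lt_of_le_of_lt hx.1 hs.1, lt_of_lt_of_le hs.2 ht.2⟩
      rw [((hw s (Ioo_subset_Icc_self hs')).hasDerivAt (Icc_mem_nhds hs'.1 hs'.2)).deriv]
      exact mul_pos (hp s) (hpos s ⟨hs.1.le, hs.2⟩)
    exact lt_of_le_of_lt hwx (this (left_mem_Icc.2 ht.1.le) (right_mem_Icc.2 ht.1.le) ht.1)
  by_cases hex : ∃ t ∈ Icc x b, z t ≤ 0
  · obtain ⟨t, ht, hzt, hxt, hpos⟩ := first_zero (hzc.mono hsub) hzx hex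
    have hmono : MonotoneOn (fun s => Real.exp (K * (s - x)) * z s + ε * Real.exp (K * (b - a)) * (s - x))
        (Icc x t) := by
      have hzc' := hzc.mono ((Icc_subset_Icc_right ht.2).trans hsub)
      have hd : ∀ s ∈ Ioo x t, HasDerivAt
          (fun s => Real.exp (K * (s - x)) * z s + ε * Real.exp (K * (b - a)) * (s - x))
          (Real.exp (K * (s - x)) * (K * z s + g s) + ε * Real.exp (K * (b - a))) s := by
        intro s hs
        have hs' : s ∈ Ioo a b := ⟨lt_of_le_of_lt hx.1 hs.1, lt_of_lt_of_le hs.2 ht.2⟩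
        have h1 := (hz s (Ioo_subset_Icc_self hs')).hasDerivAt (Icc_mem_nhds hs'.1 hs'.2)
        have h2 : HasDerivAt (fun s => s - x) 1 s := (hasDerivAt_id s).sub_const x
        have h3 := (h2.const_mul K).exp
        exact ((h3.mul h1).add (h2.const_mul (ε * Real.exp (K * (b - a))))).congr_deriv (by ring)
      refine monotoneOn_of_deriv_nonneg (convex_Icc _ _) ?_ ?_ ?_
      · fun_prop
      · intro s hs
        rw [interior_Icc] at hs
        exact (hd s hs).differentiableAt.differentiableWithinAt
      · intro s hs
        rw [interior_Icc] at hs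
        rw [(hd s hs).deriv]
        have hs' : s ∈ Ioo a b := ⟨lt_of_le_of_lt hx.1 hs.1, lt_of_lt_of_le hs.2 ht.2⟩
        have h1 := hg s (Ioo_subset_Icc_self hs')
          (key s ⟨hs.1, hs'.2.le⟩ fun r hr => hpos r ⟨hr.1, hr.2.trans hs.2⟩) (hpos s ⟨hs.1.le, hs.2⟩)
        have h2 : Real.exp (K * (s - x)) ≤ Real.exp (K * (b - a)) := by
          apply Real.exp_le_exp.2
          apply mul_le_mul_of_nonneg_left _ hK
          linarith [hx.1, hs'.2]
        have h3 := Real.exp_pos (K * (s - x))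
        have h4 : Real.exp (K * (s - x)) * (-ε) ≤ Real.exp (K * (s - x)) * (K * z s + g s) :=
          mul_le_mul_of_nonneg_left (by linarith) h3.le
        nlinarith
    have h1 := hmono (left_mem_Icc.2 hxt.le) (right_mem_Icc.2 hxt.le) hxt.le
    simp only [sub_self, mul_zero, Real.exp_zero, one_mul, add_zero] at h1
    have h2 : Real.exp (K * (t - x)) * z t ≤ 0 :=
      mul_nonpos_of_nonneg_of_nonpos (Real.exp_pos _).le hzt
    have h3 : ε * Real.exp (K * (b - a)) * (t - x) ≤ ε * Real.exp (K * (b - a)) * (b - a) := by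
      apply mul_le_mul_of_nonneg_left _ (by positivity)
      linarith [hx.1, ht.2]
    linarith
  · push Not at hex
    have := key b ⟨hx.2, le_rfl⟩ fun s hs => hex s ⟨hs.1, hs.2.le⟩
    linarith

lemma stab_one {p w z g : ℝ → ℝ} {a b K ε : ℝ} (hab : a < b) (hp : ∀ x, 0 < p x) (hK : 0 ≤ K)
    (hε : 0 ≤ ε)
    (hw : ∀ x ∈ Icc a b, HasDerivWithinAt w (p x * z x) (Icc a b) x)
    (hz : ∀ x ∈ Icc a b, HasDerivWithinAt z (g x) (Icc a b) x)
    (hg : ∀ x ∈ Icc a b, 0 < w x → 0 < z x → -K * z x - ε ≤ g x)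
    (hg' : ∀ x ∈ Icc a b, w x < 0 → 0 < z x → g x ≤ K * z x + ε)
    (hwa : w a = 0) (hwb : w b = 0) {x : ℝ} (hx : x ∈ Icc a b) :
    z x ≤ (b - a) * Real.exp (K * (b - a)) * ε := by
  by_cases hc : x < b ∧ 0 ≤ w x
  · exact stab_right hp hK hε hw hz hg hwb.le ⟨hx.1, hc.1⟩ hc.2
  · have hwx : w x ≤ 0 := by
      by_contra! h
      rcases eq_or_lt_of_le hx.2 with h1 | h1
      · rw [h1] at h; linarith
      · exact hc ⟨h1, h.le⟩
    have hax : a < x := by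
      rcases eq_or_lt_of_le hx.1 with h1 | h1
      · exact absurd ⟨h1 ▸ hab, by rw [← h1]; exact hwa.ge⟩ hc
      · exact h1
    have hm : MapsTo (fun t => a + b - t) (Icc a b) (Icc a b) := by
      intro t ht
      simp only [mem_Icc] at ht ⊢
      constructor <;> linarith [ht.1, ht.2]
    have hr : ∀ t, HasDerivWithinAt (fun t => a + b - t) (-1) (Icc a b) t := fun t =>
      ((hasDerivAt_id t).const_sub (a + b)).hasDerivWithinAt
    have := stab_right (p := fun t => p (a + b - t)) (w := fun t => - w (a + b - t))
      (z := fun t => z (a + b - t)) (g := fun t => - g (a + b - t)) (a := a) (b := b)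
      (x := a + b - x) (fun t => hp _) hK hε ?_ ?_ ?_ (by simp [hwa]) ⟨by linarith [hx.2], by linarith⟩
      (by simpa using hwx)
    · simpa using this
    · intro t ht
      exact ((hw _ (hm ht)).comp t (hr t) hm).neg.congr_deriv (by ring)
    · intro t ht
      exact ((hz _ (hm ht)).comp t (hr t) hm).congr_deriv (by ring)
    · intro t ht h1 h2
      have := hg' _ (hm ht) (by linarith) h2
      linarith

lemma stab {p : ℝ → ℝ} {a b A B K ε : ℝ} (hab : a < b) (hp : ∀ x, 0 < p x) (hK : 0 ≤ K)
    {G : ℝ → ℝ → ℝ → ℝ} (hmono : ∀ x y y' z, y ≤ y' → G x y z ≤ G x y' z)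
    (hLip : ∀ x y z z', |G x y z - G x y z'| ≤ K * |z - z'|)
    {h1 h2 u1 u2 v1 v2 : ℝ → ℝ} (s1 : BSol p a b A B G h1 u1 v1) (s2 : BSol p a b A B G h2 u2 v2)
    (hh : ∀ x ∈ Icc a b, |h1 x - h2 x| ≤ ε) :
    ∀ x ∈ Icc a b, |v1 x - v2 x| ≤ (b - a) * Real.exp (K * (b - a)) * ε := by
  have hε : 0 ≤ ε := (abs_nonneg _).trans (hh a (left_mem_Icc.2 hab.le))
  have one : ∀ {h1 h2 u1 u2 v1 v2 : ℝ → ℝ}, BSol p a b A B G h1 u1 v1 → BSol p a b A B G h2 u2 v2 →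
    (∀ x ∈ Icc a b, |h1 x - h2 x| ≤ ε) →
    ∀ x ∈ Icc a b, v1 x - v2 x ≤ (b - a) * Real.exp (K * (b - a)) * ε := by
    intro h1 h2 u1 u2 v1 v2 s1 s2 hh x hx
    refine stab_one (p := p) (w := fun x => u1 x - u2 x) (z := fun x => v1 x - v2 x)
      (g := fun x => (G x (u1 x) (v1 x) + h1 x) - (G x (u2 x) (v2 x) + h2 x))
      hab hp hK hε ?_ ?_ ?_ ?_ ?_ ?_ hx
    · intro t ht
      exact ((s1.du t ht).sub (s2.du t ht)).congr_deriv (by ring)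
    · intro t ht
      exact (s1.dv t ht).sub (s2.dv t ht)
    · intro t ht hw hz
      have e1 := hmono t _ _ (v1 t) (sub_pos.1 hw).le
      have e2 := abs_le.1 (hLip t (u2 t) (v1 t) (v2 t))
      rw [abs_of_pos hz] at e2
      have e3 := abs_le.1 (hh t ht)
      linarith [e2.1, e3.1]
    · intro t ht hw hz
      have e1 := hmono t _ _ (v1 t) (sub_neg.1 hw).le
      have e2 := abs_le.1 (hLip t (u2 t) (v1 t) (v2 t))
      rw [abs_of_pos hz] at e2
      have e3 := abs_le.1 (hh t ht)
      linarith [e2.2, e3.2]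
    · simp [s1.ua, s2.ua]
    · simp [s1.ub, s2.ub]
  intro x hx
  rw [abs_le]
  have := one s1 s2 hh x hx
  have := one s2 s1 (fun y hy => by rw [abs_sub_comm]; exact hh y hy) x hx
  constructor <;> linarith

lemma stab_u {p : ℝ → ℝ} {a b A B A' B' P δ : ℝ} (hab : a < b) (hP : ∀ x, |p x| ≤ P)
    {G G' : ℝ → ℝ → ℝ → ℝ}
    {h1 h2 u1 u2 v1 v2 : ℝ → ℝ} (s1 : BSol p a b A B G h1 u1 v1) (s2 : BSol p a b A' B' G' h2 u2 v2)
    (hA : A = A')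
    (hh : ∀ x ∈ Icc a b, |v1 x - v2 x| ≤ δ) :
    ∀ x ∈ Icc a b, |u1 x - u2 x| ≤ P * δ * (b - a) := by
  intro x hx
  have hP0 : 0 ≤ P := (abs_nonneg _).trans (hP a)
  have hδ : 0 ≤ δ := (abs_nonneg _).trans (hh a (left_mem_Icc.2 hab.le))
  have := norm_image_sub_le_of_norm_deriv_le_segment' (f := fun x => u1 x - u2 x) (a := a) (b := b)
    (C := P * δ) (f' := fun x => p x * v1 x - p x * v2 x)
    (fun t ht => (s1.du t ht).sub (s2.du t ht)) (by
      intro t ht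
      rw [← mul_sub, Real.norm_eq_abs, abs_mul]
      exact mul_le_mul (hP t) (hh t (Ico_subset_Icc_self ht)) (abs_nonneg _) hP0) x hx
  simp only [s1.ua, s2.ua, hA, sub_self, sub_zero, Real.norm_eq_abs] at this
  refine this.trans ?_
  apply mul_le_mul_of_nonneg_left _ (by positivity)
  linarith [hx.2]

lemma BSol.cu {p : ℝ → ℝ} {a b A B : ℝ} {G : ℝ → ℝ → ℝ → ℝ} {h u v : ℝ → ℝ}
    (s : BSol p a b A B G h u v) : ContinuousOn u (Icc a b) :=
  fun x hx => (s.du x hx).continuousWithinAt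

lemma BSol.cv {p : ℝ → ℝ} {a b A B : ℝ} {G : ℝ → ℝ → ℝ → ℝ} {h u v : ℝ → ℝ}
    (s : BSol p a b A B G h u v) : ContinuousOn v (Icc a b) :=
  fun x hx => (s.dv x hx).continuousWithinAt

lemma BSol.congr {p : ℝ → ℝ} {a b A B : ℝ} {G G' : ℝ → ℝ → ℝ → ℝ} {h h' u v : ℝ → ℝ}
    (s : BSol p a b A B G h u v)
    (e : ∀ x ∈ Icc a b, G x (u x) (v x) + h x = G' x (u x) (v x) + h' x) :
    BSol p a b A B G' h' u v :=
  ⟨s.ua, s.ub, s.du, fun x hx => e x hx ▸ s.dv x hx⟩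

lemma base_sol {p : ℝ → ℝ} {a b A B : ℝ} (hab : a < b) (hp : ∀ x, 0 < p x) (hpc : Continuous p)
    {h : ℝ → ℝ} (hh : Continuous h) :
    ∃ u v, BSol p a b A B (fun _ _ _ => 0) h u v := by
  have hI : 0 < ∫ y in a..b, p y := intervalIntegral_pos_of_pos (hpc.intervalIntegrable _ _) hp hab
  set H : ℝ → ℝ := fun x => ∫ y in a..x, h y with hH
  have hHd : ∀ x, HasDerivAt H (h x) x := fun x => hh.integral_hasStrictDerivAt a x |>.hasDerivAt
  have hHc : Continuous H := continuous_iff_continuousAt.2 fun x => (hHd x).continuousAt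
  set c := (B - A - ∫ y in a..b, p y * H y) / ∫ y in a..b, p y with hc
  have hvc : Continuous fun x => p x * (c + H x) := by fun_prop
  refine ⟨fun x => A + ∫ y in a..x, p y * (c + H y), fun x => c + H x, by simp, ?_, ?_, ?_⟩
  · have : ∫ y in a..b, p y * (c + H y) = c * (∫ y in a..b, p y) + ∫ y in a..b, p y * H y := by
      rw [← intervalIntegral.integral_const_mul, ← intervalIntegral.integral_add]
      · congr 1; ext y; ring
      · exact (hpc.const_mul c).intervalIntegrable _ _
      · exact (hpc.mul hHc).intervalIntegrable _ _
    simp only [this]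
    rw [hc]
    field_simp
    ring
  · intro x hx
    exact ((hvc.integral_hasStrictDerivAt a x).hasDerivAt.const_add A).hasDerivWithinAt
  · intro x hx
    simpa using ((hHd x).const_add c).hasDerivWithinAt

lemma cont_method {p : ℝ → ℝ} {a b A B K P Λ : ℝ} (hab : a < b) (hp : ∀ x, 0 < p x)
    (hpc : Continuous p) (hP : ∀ x, |p x| ≤ P) (hK : 0 ≤ K) (hΛ : 0 ≤ Λ)
    {G : ℝ → ℝ → ℝ → ℝ} (hG : Continuous fun q : ℝ × ℝ × ℝ => G q.1 q.2.1 q.2.2)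
    (hmono : ∀ x y y' z, y ≤ y' → G x y z ≤ G x y' z)
    (hLip : ∀ x y z z', |G x y z - G x y z'| ≤ K * |z - z'|)
    (hLip2 : ∀ x y y' z, |G x y z - G x y' z| ≤ Λ * |y - y'|) :
    ∃ u v, BSol p a b A B G (fun _ => 0) u v := by
  have hba : 0 < b - a := sub_pos.2 hab
  have hP0 : 0 ≤ P := (abs_nonneg _).trans (hP a)
  set C := (b - a) * Real.exp (K * (b - a)) with hC
  have hC0 : 0 ≤ C := by positivity
  set Q := Λ * (P * C * (b - a)) + K * C with hQ
  have hQ0 : 0 ≤ Q := by positivity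
  obtain ⟨m, hm⟩ := exists_nat_gt Q
  have hm0 : (0:ℝ) < m := lt_of_le_of_lt hQ0 hm
  have main : ∀ j : ℕ, j ≤ m → ∀ h : ℝ → ℝ, Continuous h →
      ∃ u v, BSol p a b A B (fun x y z => (j / m : ℝ) * G x y z) h u v := by
    intro j
    induction j with
    | zero =>
      intro _ h hh
      simpa using base_sol hab hp hpc hh
    | succ j ih =>
      intro hj h hh
      have hj' : (j / m : ℝ) ≤ 1 := by
        rw [div_le_one hm0]; exact_mod_cast (Nat.le_succ j).trans hj
      have hj0 : (0:ℝ) ≤ j / m := by positivity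
      have ih' : ∀ k : C(Icc a b, ℝ), ∃ uv : (ℝ → ℝ) × (ℝ → ℝ),
          BSol p a b A B (fun x y z => (j / m : ℝ) * G x y z) (IccExtend hab.le k) uv.1 uv.2 := by
        intro k
        obtain ⟨u, v, huv⟩ := ih ((Nat.le_succ j).trans hj) (IccExtend hab.le k)
          (k.continuous.Icc_extend' )
        exact ⟨(u, v), huv⟩
      choose U hU using ih'
      let T : C(Icc a b, ℝ) → C(Icc a b, ℝ) := fun k =>
        ⟨fun x => h x + (1 / m) * G x ((U k).1 x) ((U k).2 x), by
          have h1 : Continuous fun x : Icc a b => (U k).1 x := (hU k).cu.domRestrict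
          have h2 : Continuous fun x : Icc a b => (U k).2 x := (hU k).cv.domRestrict
          have h3 : Continuous fun x : Icc a b => G x ((U k).1 x) ((U k).2 x) :=
            hG.comp (continuous_subtype_val.prodMk (h1.prodMk h2))
          fun_prop⟩
      have hT : ContractingWith (Real.toNNReal (Q / m)) T := by
        refine ⟨?_, ?_⟩
        · rw [Real.toNNReal_lt_one, div_lt_one hm0]
          exact hm
        · refine LipschitzWith.of_dist_le_mul fun k k' => ?_
          rw [Real.coe_toNNReal _ (by positivity)]
          rw [ContinuousMap.dist_le (by positivity)]
          intro x
          have e1 := stab (G := fun x y z => (j / m : ℝ) * G x y z) hab hp hK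
            (fun x y y' z hy => mul_le_mul_of_nonneg_left (hmono x y y' z hy) hj0)
            (fun x y z z' => by
              rw [← mul_sub, abs_mul, abs_of_nonneg hj0]
              calc _ ≤ 1 * |G x y z - G x y z'| := mul_le_mul_of_nonneg_right hj' (abs_nonneg _)
                _ ≤ _ := by rw [one_mul]; exact hLip x y z z') (hU k) (hU k') (ε := dist k k')
              (fun y hy => by
                rw [IccExtend_of_mem _ _ hy, IccExtend_of_mem _ _ hy, ← Real.dist_eq]
                exact ContinuousMap.dist_apply_le_dist _)
          have e2 := stab_u hab hP (hU k) (hU k') rfl e1 x x.2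
          have e1 := e1 x x.2
          have e3 := hLip x ((U k).1 x) ((U k).2 x) ((U k').2 x)
          have e4 := hLip2 x ((U k).1 x) ((U k').1 x) ((U k').2 x)
          have e5 := abs_sub_le (G x ((U k).1 x) ((U k).2 x)) (G x ((U k).1 x) ((U k').2 x))
            (G x ((U k').1 x) ((U k').2 x))
          have e6 := mul_le_mul_of_nonneg_left e1 hK
          have e7 := mul_le_mul_of_nonneg_left e2 hΛ
          have e8 : |G x ((U k).1 x) ((U k).2 x) - G x ((U k').1 x) ((U k').2 x)| ≤ Q * dist k k' := by
            rw [hQ]; rw [← hC] at e6 e7; linarith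
          rw [Real.dist_eq]
          show |(h x + (1 / m) * G x ((U k).1 x) ((U k).2 x)) -
            (h x + (1 / m) * G x ((U k').1 x) ((U k').2 x))| ≤ _
          rw [add_sub_add_left_eq_sub, ← mul_sub, abs_mul, abs_of_pos (by positivity)]
          calc _ ≤ (1 / m : ℝ) * (Q * dist k k') := mul_le_mul_of_nonneg_left e8 (by positivity)
            _ = _ := by ring
      have : Nonempty C(Icc a b, ℝ) := ⟨0⟩
      have hfix := hT.fixedPoint_isFixedPt
      set k := ContractingWith.fixedPoint T hT with hk
      refine ⟨(U k).1, (U k).2, (hU k).congr ?_⟩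
      intro x hx
      rw [IccExtend_of_mem _ _ hx]
      have : T k ⟨x, hx⟩ = k ⟨x, hx⟩ := by rw [hfix]
      rw [← this]
      show _ + (h x + (1 / m) * G x ((U k).1 x) ((U k).2 x)) = _
      push_cast
      ring
  obtain ⟨u, v, huv⟩ := main m le_rfl (fun _ => 0) continuous_const
  exact ⟨u, v, huv.congr fun x _ => by simp [hm0.ne']⟩

/-- mollification in the second variable -/
noncomputable def moll (G : ℝ → ℝ → ℝ → ℝ) (δ : ℝ) (x y z : ℝ) : ℝ :=
  ∫ s in (0:ℝ)..1, G x (y + δ * s) z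

section
variable {G : ℝ → ℝ → ℝ → ℝ} (hG : Continuous fun q : ℝ × ℝ × ℝ => G q.1 q.2.1 q.2.2) {δ : ℝ}
include hG

lemma moll_aux (x z : ℝ) : Continuous fun y => G x y z :=
  hG.comp (by fun_prop : Continuous fun y : ℝ => (x, y, z))

lemma moll_int (x y z : ℝ) : IntervalIntegrable (fun s => G x (y + δ * s) z) volume 0 1 :=
  ((moll_aux hG x z).comp (by fun_prop : Continuous fun s : ℝ => y + δ * s)).intervalIntegrable _ _

lemma moll_cont : Continuous fun q : ℝ × ℝ × ℝ => moll G δ q.1 q.2.1 q.2.2 := by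
  unfold moll
  apply intervalIntegral.continuous_parametric_intervalIntegral_of_continuous'
  exact hG.comp (by fun_prop : Continuous fun r : (ℝ × ℝ × ℝ) × ℝ =>
    (r.1.1, r.1.2.1 + δ * r.2, r.1.2.2))

lemma moll_mono (hmono : ∀ x y y' z, y ≤ y' → G x y z ≤ G x y' z) (x y y' z : ℝ) (h : y ≤ y') :
    moll G δ x y z ≤ moll G δ x y' z :=
  intervalIntegral.integral_mono_on zero_le_one (moll_int hG _ _ _) (moll_int hG _ _ _)
    fun s _ => hmono _ _ _ _ (by linarith)

lemma moll_lip {K : ℝ} (hLip : ∀ x y z z', |G x y z - G x y z'| ≤ K * |z - z'|) (x y z z' : ℝ) :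
    |moll G δ x y z - moll G δ x y z'| ≤ K * |z - z'| := by
  unfold moll
  rw [← intervalIntegral.integral_sub (moll_int hG _ _ _) (moll_int hG _ _ _)]
  have := intervalIntegral.norm_integral_le_of_norm_le_const (a := (0:ℝ)) (b := 1)
    (f := fun s => G x (y + δ * s) z - G x (y + δ * s) z') (C := K * |z - z'|)
    (fun s _ => hLip _ _ _ _)
  simpa using this

lemma moll_close {ε : ℝ} (hδ : 0 ≤ δ)
    (hc : ∀ x y y' z, |y - y'| ≤ δ → |G x y z - G x y' z| ≤ ε) (x y z : ℝ) :
    |moll G δ x y z - G x y z| ≤ ε := by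
  have e : G x y z = ∫ s in (0:ℝ)..1, G x y z := by simp
  unfold moll
  rw [e, ← intervalIntegral.integral_sub (moll_int hG _ _ _) (by simp)]
  have := intervalIntegral.norm_integral_le_of_norm_le_const (a := (0:ℝ)) (b := 1)
    (f := fun s => G x (y + δ * s) z - G x y z) (C := ε)
    (fun s hs => hc _ _ _ _ (by
      rw [uIoc_of_le zero_le_one] at hs
      rw [add_sub_cancel_left, abs_of_nonneg (mul_nonneg hδ hs.1.le)]
      nlinarith [hs.2]))
  simpa using this

lemma moll_lip2 {M : ℝ} (hδ : 0 < δ) (hM : ∀ x y z, |G x y z| ≤ M) (x y y' z : ℝ) :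
    |moll G δ x y z - moll G δ x y' z| ≤ (2 * M / δ) * |y - y'| := by
  have hi : ∀ s t, IntervalIntegrable (fun y => G x y z) volume s t := fun s t =>
    (moll_aux hG x z).intervalIntegrable _ _
  have e : ∀ y, moll G δ x y z = δ⁻¹ * ∫ s in y..(y + δ), G x s z := by
    intro y
    unfold moll
    have := intervalIntegral.integral_comp_add_mul (a := 0) (b := 1) (fun s => G x s z) hδ.ne' y
    simpa using this
  rw [e, e, ← mul_sub, intervalIntegral.integral_interval_sub_interval_comm (hi _ _) (hi _ _) (hi _ _)]
  have b1 : ∀ s t, |∫ r in s..t, G x r z| ≤ M * |t - s| := by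
    intro s t
    rw [← Real.norm_eq_abs]
    exact intervalIntegral.norm_integral_le_of_norm_le_const (fun r _ => hM _ _ _)
  have h1 := b1 y y'
  have h2 := b1 (y + δ) (y' + δ)
  rw [add_sub_add_right_eq_sub] at h2
  rw [abs_sub_comm y' y] at h1 h2
  rw [abs_mul, abs_of_pos (inv_pos.2 hδ)]
  have h3 := (abs_sub _ _ : |(∫ r in y..y', G x r z) - ∫ r in (y + δ)..(y' + δ), G x r z| ≤ _)
  calc _ ≤ δ⁻¹ * (2 * M * |y - y'|) := mul_le_mul_of_nonneg_left (by linarith) (inv_pos.2 hδ).le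
    _ = _ := by field_simp
end

lemma ftc1 {a b : ℝ} {w g : ℝ → ℝ} (hw : ∀ x ∈ Icc a b, HasDerivWithinAt w (g x) (Icc a b) x)
    (hg : ContinuousOn g (Icc a b)) : ∀ x ∈ Icc a b, ∫ y in a..x, g y = w x - w a := by
  intro x hx
  have hs : Icc a x ⊆ Icc a b := Icc_subset_Icc_right hx.2
  refine intervalIntegral.integral_eq_sub_of_hasDerivAt_of_le hx.1
    (fun y hy => ((hw y (hs hy)).continuousWithinAt).mono hs) ?_ ?_
  · intro y hy
    have hy' : y ∈ Ioo a b := ⟨hy.1, lt_of_lt_of_le hy.2 hx.2⟩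
    exact (hw y (Ioo_subset_Icc_self hy')).hasDerivAt (Icc_mem_nhds hy'.1 hy'.2)
  · exact ContinuousOn.intervalIntegrable (by rw [uIcc_of_le hx.1]; exact hg.mono hs)

lemma ftc2 {a b : ℝ} (hab : a < b) {g : ℝ → ℝ} (hg : ContinuousOn g (Icc a b)) :
    ∀ x ∈ Icc a b, HasDerivWithinAt (fun x => ∫ y in a..x, g y) (g x) (Icc a b) x := by
  intro x hx
  have hc : Continuous (IccExtend hab.le ((Icc a b).domRestrict g)) :=
    (hg.domRestrict).Icc_extend'
  have e : ∀ y ∈ Icc a b, IccExtend hab.le ((Icc a b).domRestrict g) y = g y := fun y hy => by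
    rw [IccExtend_of_mem _ _ hy]; rfl
  have := (hc.integral_hasStrictDerivAt a x).hasDerivAt.hasDerivWithinAt (s := Icc a b)
  rw [e x hx] at this
  have e2 : ∀ t ∈ Icc a b, ∫ y in a..t, g y =
      ∫ y in a..t, IccExtend hab.le ((Icc a b).domRestrict g) y := by
    intro t ht
    refine intervalIntegral.integral_congr fun y hy => ?_
    rw [uIcc_of_le ht.1] at hy
    exact (e y ⟨hy.1, hy.2.trans ht.2⟩).symm
  exact this.congr e2 (e2 x hx)

lemma comp3 {G : ℝ → ℝ → ℝ → ℝ} (hG : Continuous fun q : ℝ × ℝ × ℝ => G q.1 q.2.1 q.2.2)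
    {u v : ℝ → ℝ} {s : Set ℝ} (hu : ContinuousOn u s) (hv : ContinuousOn v s) :
    ContinuousOn (fun x => G x (u x) (v x)) s :=
  hG.comp_continuousOn (continuousOn_id.prodMk (hu.prodMk hv))

open Filter Topology in
lemma bdd_exists {p : ℝ → ℝ} {a b A B K P M : ℝ} (hab : a < b) (hp : ∀ x, 0 < p x)
    (hpc : Continuous p) (hP : ∀ x, |p x| ≤ P) (hK : 0 ≤ K)
    {G : ℝ → ℝ → ℝ → ℝ} (hG : Continuous fun q : ℝ × ℝ × ℝ => G q.1 q.2.1 q.2.2)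
    (hmono : ∀ x y y' z, y ≤ y' → G x y z ≤ G x y' z)
    (hLip : ∀ x y z z', |G x y z - G x y z'| ≤ K * |z - z'|)
    (hM : ∀ x y z, |G x y z| ≤ M)
    (huc : ∀ ε > 0, ∃ δ > 0, ∀ x y y' z, |y - y'| ≤ δ → |G x y z - G x y' z| ≤ ε) :
    ∃ u v, BSol p a b A B G (fun _ => 0) u v := by
  have hba : 0 < b - a := sub_pos.2 hab
  have hP0 : 0 ≤ P := (abs_nonneg _).trans (hP a)
  have hM0 : 0 ≤ M := (abs_nonneg _).trans (hM 0 0 0)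
  set C := (b - a) * Real.exp (K * (b - a)) with hC
  have hC0 : 0 ≤ C := by positivity
  have hap : ∀ n : ℕ, ∃ (N : ℝ → ℝ → ℝ → ℝ) (u v : ℝ → ℝ),
      (Continuous fun q : ℝ × ℝ × ℝ => N q.1 q.2.1 q.2.2) ∧
      (∀ x y z, |N x y z - G x y z| ≤ 1 / ((n:ℝ) + 1)) ∧ BSol p a b A B N (fun _ => 0) u v := by
    intro n
    obtain ⟨δ, hδ, hc⟩ := huc (1 / ((n:ℝ) + 1)) (by positivity)
    obtain ⟨u, v, h⟩ := cont_method (A := A) (B := B) hab hp hpc hP hK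
      (Λ := 2 * M / δ) (by positivity) (moll_cont hG (δ := δ))
      (moll_mono hG hmono) (moll_lip hG hLip) (moll_lip2 hG hδ hM)
    exact ⟨moll G δ, u, v, moll_cont hG, moll_close hG hδ.le hc, h⟩
  choose N u v hNc hN hs using hap
  have hs' : ∀ n, BSol p a b A B G (fun x => N n x (u n x) (v n x) - G x (u n x) (v n x)) (u n) (v n) :=
    fun n => (hs n).congr fun x _ => by ring
  have hmono1 : ∀ {n m : ℕ}, m ≤ n → 1 / ((n:ℝ) + 1) ≤ 1 / ((m:ℝ) + 1) := fun h =>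
    Nat.one_div_le_one_div h
  have hst : ∀ n m k : ℕ, k ≤ n → k ≤ m → ∀ x ∈ Icc a b,
      |v n x - v m x| ≤ C * (2 * (1 / ((k:ℝ) + 1))) := by
    intro n m k hn hm
    refine stab hab hp hK hmono hLip (hs' n) (hs' m) fun x _ => ?_
    have h1 := (hN n x (u n x) (v n x)).trans (hmono1 hn)
    have h2 := (hN m x (u m x) (v m x)).trans (hmono1 hm)
    have h3 := abs_sub (N n x (u n x) (v n x) - G x (u n x) (v n x))
      (N m x (u m x) (v m x) - G x (u m x) (v m x))
    linarith
  let W : ℕ → C(Icc a b, ℝ) := fun n => ⟨fun x => v n x, (hs n).cv.domRestrict⟩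
  have hCau : CauchySeq W := by
    refine cauchySeq_of_le_tendsto_0 (fun k : ℕ => C * (2 * (1 / ((k:ℝ) + 1)))) ?_ ?_
    · intro n m k hn hm
      rw [ContinuousMap.dist_le (by positivity)]
      intro x
      exact hst n m k hn hm x x.2
    · have := (tendsto_one_div_add_atTop_nhds_zero_nat (𝕜 := ℝ)).const_mul 2 |>.const_mul C
      simpa using this
  obtain ⟨V, hV⟩ := cauchySeq_tendsto_of_complete hCau
  set vv : ℝ → ℝ := IccExtend hab.le V with hvv
  have hvc : Continuous vv := V.continuous.Icc_extend'
  have hvt : ∀ x ∈ Icc a b, Tendsto (fun n => v n x) atTop (𝓝 (vv x)) := by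
    intro x hx
    have := ((ContinuousEvalConst.continuous_eval_const (F := C(Icc a b, ℝ)) (⟨x, hx⟩ : Icc a b)).tendsto V).comp hV
    rw [hvv, IccExtend_of_mem _ _ hx]
    exact this
  set uu : ℝ → ℝ := fun x => A + ∫ y in a..x, p y * vv y with huu
  have hpv : Continuous fun y => p y * vv y := hpc.mul hvc
  have hud : ∀ x, HasDerivAt uu (p x * vv x) x := fun x =>
    (hpv.integral_hasStrictDerivAt a x).hasDerivAt.const_add A
  have huc' : Continuous uu := continuous_iff_continuousAt.2 fun x => (hud x).continuousAt
  have hpvn : ∀ n, ContinuousOn (fun y => p y * v n y) (Icc a b) := fun n =>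
    hpc.continuousOn.mul (hs n).cv
  have hsub : ∀ x ∈ Icc a b, uIoc a x ⊆ Icc a b := fun x hx => by
    rw [uIoc_of_le hx.1]; exact Ioc_subset_Icc_self.trans (Icc_subset_Icc_right hx.2)
  have hsub' : ∀ x ∈ Icc a b, uIcc a x ⊆ Icc a b := fun x hx => by
    rw [uIcc_of_le hx.1]; exact (Icc_subset_Icc_right hx.2)
  have hut : ∀ x ∈ Icc a b, Tendsto (fun n => u n x) atTop (𝓝 (uu x)) := by
    intro x hx
    have e : ∀ n, u n x = A + ∫ y in a..x, p y * v n y := by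
      intro n
      rw [ftc1 (hs n).du (hpvn n) x hx, (hs n).ua]; ring
    simp only [e, huu]
    refine Tendsto.const_add A ?_
    refine intervalIntegral.tendsto_integral_filter_of_dominated_convergence
      (fun y => P * (|v 0 y| + C * 2)) ?_ ?_ ?_ ?_
    · exact Eventually.of_forall fun n =>
        ((hpvn n).mono (hsub x hx)).aestronglyMeasurable measurableSet_uIoc
    · refine Eventually.of_forall fun n => Eventually.of_forall fun y hy => ?_
      have h1 := hst n 0 0 (Nat.zero_le _) le_rfl y (hsub x hx hy)
      have h2 := abs_sub_abs_le_abs_sub (v n y) (v 0 y)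
      rw [norm_mul]
      refine mul_le_mul (hP y) ?_ (norm_nonneg _) hP0
      rw [Real.norm_eq_abs]
      norm_num at h1
      linarith
    · refine ContinuousOn.intervalIntegrable ?_
      have := (hs 0).cv.mono (hsub' x hx)
      fun_prop
    · exact Eventually.of_forall fun y hy => (hvt y (hsub x hx hy)).const_mul _
  have hGc : Continuous fun x => G x (uu x) (vv x) :=
    hG.comp (continuous_id.prodMk (huc'.prodMk hvc))
  have hNn : ∀ n, ContinuousOn (fun x => N n x (u n x) (v n x)) (Icc a b) := fun n =>
    comp3 (hNc n) (hs n).cu (hs n).cv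
  have hvI : ∀ x ∈ Icc a b, vv x = vv a + ∫ y in a..x, G y (uu y) (vv y) := by
    intro x hx
    have ha : a ∈ Icc a b := left_mem_Icc.2 hab.le
    have t1 := (hvt x hx).sub (hvt a ha)
    have t2 : Tendsto (fun n => ∫ y in a..x, N n y (u n y) (v n y)) atTop
        (𝓝 (∫ y in a..x, G y (uu y) (vv y))) := by
      refine intervalIntegral.tendsto_integral_filter_of_dominated_convergence
        (fun y => M + 1) ?_ ?_ ?_ ?_
      · exact Eventually.of_forall fun n =>
          ((hNn n).mono (hsub x hx)).aestronglyMeasurable measurableSet_uIoc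
      · refine Eventually.of_forall fun n => Eventually.of_forall fun y hy => ?_
        have h1 := (hN n y (u n y) (v n y)).trans (hmono1 (Nat.zero_le n))
        have h2 := abs_sub_abs_le_abs_sub (N n y (u n y) (v n y)) (G y (u n y) (v n y))
        have h3 := hM y (u n y) (v n y)
        rw [Real.norm_eq_abs]
        norm_num at h1
        linarith
      · simp
      · refine Eventually.of_forall fun y hy => ?_
        have g1 : Tendsto (fun n => G y (u n y) (v n y)) atTop (𝓝 (G y (uu y) (vv y))) :=
          (hG.tendsto (y, uu y, vv y)).comp
            (tendsto_const_nhds.prodMk_nhds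
              ((hut y (hsub x hx hy)).prodMk_nhds (hvt y (hsub x hx hy))))
        have g2 : Tendsto (fun n => N n y (u n y) (v n y) - G y (u n y) (v n y)) atTop (𝓝 0) :=
          squeeze_zero_norm (fun n => hN n y (u n y) (v n y))
            (tendsto_one_div_add_atTop_nhds_zero_nat (𝕜 := ℝ))
        simpa using g2.add g1
    have e : ∀ n, ∫ y in a..x, N n y (u n y) (v n y) = v n x - v n a := fun n =>
      ftc1 (fun t ht => by simpa using (hs n).dv t ht) (hNn n) x hx
    simp only [e] at t2
    have := tendsto_nhds_unique t1 t2
    linarith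
  refine ⟨uu, vv, by simp [huu], ?_, fun x _ => (hud x).hasDerivWithinAt, ?_⟩
  · have hb : b ∈ Icc a b := right_mem_Icc.2 hab.le
    have := hut b hb
    simp only [(hs _).ub] at this
    exact tendsto_nhds_unique this tendsto_const_nhds
  · intro x hx
    have := ((hGc.integral_hasStrictDerivAt a x).hasDerivAt.const_add (vv a)).hasDerivWithinAt
      (s := Icc a b)
    simpa using this.congr hvI (hvI x hx)

lemma clamp_lip {R : ℝ} (y y' : ℝ) :
    |max (-R) (min R y) - max (-R) (min R y')| ≤ |y - y'| := by
  refine (abs_max_sub_max_le_max _ _ _ _).trans ?_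
  refine max_le (by simp) ?_
  exact (abs_min_sub_min_le_max _ _ _ _).trans (max_le (by simp) le_rfl)

lemma clamp_mem {l r : ℝ} (h : l ≤ r) (y : ℝ) : max l (min r y) ∈ Icc l r :=
  ⟨le_max_left _ _, max_le h (min_le_left _ _)⟩

lemma clamp_eq {l r y : ℝ} (h : y ∈ Icc l r) : max l (min r y) = y := by
  rw [min_eq_right h.2, max_eq_right h.1]

lemma full_exists {p : ℝ → ℝ} {a b A B K P : ℝ} (hab : a < b) (hp : ∀ x, 0 < p x)
    (hpc : Continuous p) (hP : ∀ x, |p x| ≤ P) (hK : 0 ≤ K)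
    {G : ℝ → ℝ → ℝ → ℝ} (hG : Continuous fun q : ℝ × ℝ × ℝ => G q.1 q.2.1 q.2.2)
    (hmono : ∀ x y y' z, y ≤ y' → G x y z ≤ G x y' z)
    (hLip : ∀ x y z z', |G x y z - G x y z'| ≤ K * |z - z'|) :
    ∃ u v, BSol p a b A B G (fun _ => 0) u v := by
  have hba : 0 < b - a := sub_pos.2 hab
  have hP0 : 0 ≤ P := (abs_nonneg _).trans (hP a)
  have ha : a ∈ Icc a b := left_mem_Icc.2 hab.le
  set C := (b - a) * Real.exp (K * (b - a)) with hC
  have hC0 : 0 ≤ C := by positivity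
  obtain ⟨u0, v0, h0⟩ := base_sol (A := A) (B := B) hab hp hpc (h := fun _ => 0) continuous_const
  obtain ⟨Ru, hRu⟩ := isCompact_Icc.exists_bound_of_continuousOn h0.cu
  obtain ⟨Rv, hRv⟩ := isCompact_Icc.exists_bound_of_continuousOn h0.cv
  obtain ⟨N0, hN0⟩ := isCompact_Icc.exists_bound_of_continuousOn (comp3 hG h0.cu h0.cv)
  simp only [Real.norm_eq_abs] at hRu hRv hN0
  have hRu0 := (abs_nonneg _).trans (hRu a ha)
  have hRv0 := (abs_nonneg _).trans (hRv a ha)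
  have hN00 := (abs_nonneg _).trans (hN0 a ha)
  set R := Ru + Rv + C * N0 + P * (C * N0) * (b - a) with hR
  have q1 : 0 ≤ C * N0 := by positivity
  have q2 : 0 ≤ P * (C * N0) * (b - a) := by positivity
  have hR0 : 0 ≤ R := by positivity
  have hRR : -R ≤ R := by linarith
  let H : ℝ → ℝ → ℝ → ℝ := fun x y z =>
    G (max a (min b x)) (max (-R) (min R y)) (max (-R) (min R z))
  have hHe : ∀ x ∈ Icc a b, ∀ y z, |y| ≤ R → |z| ≤ R → H x y z = G x y z := by
    intro x hx y z hy hz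
    simp only [H]
    rw [clamp_eq hx, clamp_eq (abs_le.1 hy), clamp_eq (abs_le.1 hz)]
  have hHc : Continuous fun q : ℝ × ℝ × ℝ => H q.1 q.2.1 q.2.2 :=
    hG.comp (by fun_prop : Continuous fun q : ℝ × ℝ × ℝ =>
      (max a (min b q.1), max (-R) (min R q.2.1), max (-R) (min R q.2.2)))
  have hHm : ∀ x y y' z, y ≤ y' → H x y z ≤ H x y' z := fun x y y' z h =>
    hmono _ _ _ _ (max_le_max le_rfl (min_le_min le_rfl h))
  have hHL : ∀ x y z z', |H x y z - H x y z'| ≤ K * |z - z'| := fun x y z z' =>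
    (hLip _ _ _ _).trans (mul_le_mul_of_nonneg_left (clamp_lip _ _) hK)
  have hcpt : IsCompact (Icc a b ×ˢ Icc (-R) R ×ˢ Icc (-R) R) :=
    isCompact_Icc.prod (isCompact_Icc.prod isCompact_Icc)
  have hmem : ∀ x y z, ((max a (min b x), max (-R) (min R y), max (-R) (min R z)) : ℝ × ℝ × ℝ) ∈
      (Icc a b ×ˢ Icc (-R) R ×ˢ Icc (-R) R) := fun x y z =>
    ⟨clamp_mem hab.le _, clamp_mem hRR _, clamp_mem hRR _⟩
  obtain ⟨M, hM⟩ := hcpt.exists_bound_of_continuousOn hG.continuousOn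
  have hunif := hcpt.uniformContinuousOn_of_continuous hG.continuousOn
  obtain ⟨u, v, h⟩ := bdd_exists (A := A) (B := B) (M := M) hab hp hpc hP hK hHc hHm hHL
    (fun x y z => hM _ (hmem x y z)) (by
      intro ε hε
      obtain ⟨δ, hδ, hd⟩ := Metric.uniformContinuousOn_iff.1 hunif ε hε
      refine ⟨δ / 2, by positivity, fun x y y' z hy => ?_⟩
      have := hd _ (hmem x y z) _ (hmem x y' z) (by
        rw [Prod.dist_eq, Prod.dist_eq]
        simp only [dist_self]
        rw [max_eq_left dist_nonneg, max_eq_right dist_nonneg, Real.dist_eq]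
        exact ((clamp_lip y y').trans hy).trans_lt (by linarith))
      exact (le_of_lt this))
  have h0' : BSol p a b A B H (fun x => - G x (u0 x) (v0 x)) u0 v0 := h0.congr fun x hx => by
    rw [hHe x hx _ _ ((hRu x hx).trans (by linarith)) ((hRv x hx).trans (by linarith))]; ring
  have e1 := stab hab hp hK hHm hHL h h0' (ε := N0) (fun x hx => by simpa using hN0 x hx)
  have e2 := stab_u hab hP h h0' rfl e1
  rw [← hC] at e1 e2
  refine ⟨u, v, h.congr fun x hx => ?_⟩
  rw [hHe x hx]
  · have := e2 x hx
    have := abs_sub_abs_le_abs_sub (u x) (u0 x)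
    have := hRu x hx
    linarith
  · have := e1 x hx
    have := abs_sub_abs_le_abs_sub (v x) (v0 x)
    have := hRv x hx
    linarith

/-- if `F` is continuous, `(x,y) ↦ F(x,y,0)` has linear growth in `y`
uniformly in `x ∈ [a,b]`, `F` is non-decreasing in the second variable, and globally
Lipschitz in the third variable, then for every `A, B` there is exactly one solution
of the boundary value problem `Lu = F(x,u,u')`, `u(a) = A`, `u(b) = B`. -/
theorem bvp_exists_unique_solution
    (σ Sig : ℝ → ℝ) (hσ : Continuous σ) (hSig : Continuous Sig)
    (hσpos : ∀ x, 0 < σ x) (a b : ℝ) (hab : a < b)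
    (F : ℝ → ℝ → ℝ → ℝ)
    (hF : ContinuousOn (fun p : ℝ × ℝ × ℝ => F p.1 p.2.1 p.2.2)
      {p : ℝ × ℝ × ℝ | p.1 ∈ Icc a b})
    (hgrowth : ∃ c : ℝ, ∀ x ∈ Icc a b, ∀ y : ℝ, |F x y 0| ≤ c * (1 + |y|))
    (hmono : ∀ x ∈ Icc a b, ∀ y ytilde z : ℝ,
      0 ≤ (F x y z - F x ytilde z) * (y - ytilde))
    (hLip : ∃ k : ℝ, ∀ x ∈ Icc a b, ∀ y z ztilde : ℝ,
      |F x y z - F x y ztilde| ≤ k * |z - ztilde|)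
    (A B : ℝ) :
    ∃ u : ℝ → ℝ, IsBVPSolutionF σ Sig a b A B F u ∧
      ∀ v : ℝ → ℝ, IsBVPSolutionF σ Sig a b A B F v → EqOn v u (Icc a b) := by
  obtain ⟨k, hk⟩ := hLip
  have ha : a ∈ Icc a b := left_mem_Icc.2 hab.le
  have hcl : Continuous fun x : ℝ => max a (min b x) := by fun_prop
  have hcm : ∀ x, max a (min b x) ∈ Icc a b := clamp_mem hab.le
  set c : ℝ → ℝ := fun x => max a (min b x) with hc
  have hce : ∀ x ∈ Icc a b, c x = x := fun x hx => clamp_eq hx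
  let p : ℝ → ℝ := fun x => Real.exp (-(Sig (c x)))
  have hpc : Continuous p := by fun_prop
  have hp : ∀ x, 0 < p x := fun x => Real.exp_pos _
  have hpe : ∀ x ∈ Icc a b, p x = Real.exp (-(Sig x)) := fun x hx => by simp only [p, hce x hx]
  obtain ⟨P, hP⟩ : ∃ P, ∀ x, |p x| ≤ P := by
    obtain ⟨P, hP⟩ := isCompact_Icc.exists_bound_of_continuousOn
      (s := Icc a b) (f := fun x => Real.exp (-(Sig x))) (by fun_prop)
    exact ⟨P, fun x => hP _ (hcm x)⟩
  have hσ0 : ∀ x, (σ x) ^ 2 ≠ 0 := fun x => (pow_pos (hσpos x) 2).ne'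
  obtain ⟨Q, hQ⟩ : ∃ Q, ∀ x ∈ Icc a b, ‖2 / (σ x) ^ 2‖ ≤ Q :=
    isCompact_Icc.exists_bound_of_continuousOn
      (continuous_const.div (hσ.pow 2) hσ0).continuousOn
  have hQ0 : 0 ≤ Q := (norm_nonneg _).trans (hQ a ha)
  let G : ℝ → ℝ → ℝ → ℝ := fun x y z =>
    2 * (Real.exp (Sig (c x)) * F (c x) y (Real.exp (-(Sig (c x))) * z) / (σ (c x)) ^ 2)
  have hGe : ∀ x ∈ Icc a b, ∀ y z, G x y z =
      2 * (Real.exp (Sig x) * F x y (Real.exp (-(Sig x)) * z) / (σ x) ^ 2) := fun x hx y z => by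
    simp only [G, hce x hx]
  have hGc : Continuous fun q : ℝ × ℝ × ℝ => G q.1 q.2.1 q.2.2 := by
    have h1 : Continuous fun q : ℝ × ℝ × ℝ =>
        F (c q.1) q.2.1 (Real.exp (-(Sig (c q.1))) * q.2.2) :=
      hF.comp_continuous (f := fun q : ℝ × ℝ × ℝ =>
        (c q.1, q.2.1, Real.exp (-(Sig (c q.1))) * q.2.2)) (by fun_prop) fun q => hcm q.1
    have h2 : Continuous fun q : ℝ × ℝ × ℝ => Real.exp (Sig (c q.1)) := by fun_prop
    have h3 : Continuous fun q : ℝ × ℝ × ℝ => (σ (c q.1)) ^ 2 := by fun_prop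
    exact continuous_const.mul ((h2.mul h1).div h3 fun q => hσ0 _)
  have hGm : ∀ x y y' z, y ≤ y' → G x y z ≤ G x y' z := by
    intro x y y' z hy
    have h1 : F (c x) y (Real.exp (-(Sig (c x))) * z) ≤
        F (c x) y' (Real.exp (-(Sig (c x))) * z) := by
      rcases eq_or_lt_of_le hy with rfl | hy
      · exact le_rfl
      · have := hmono (c x) (hcm x) y' y (Real.exp (-(Sig (c x))) * z)
        exact sub_nonneg.1 (nonneg_of_mul_nonneg_left this (sub_pos.2 hy))
    have h2 := Real.exp_pos (Sig (c x))
    have h3 := pow_pos (hσpos (c x)) 2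
    simp only [G]
    gcongr
  have hGL : ∀ x y z z', |G x y z - G x y z'| ≤ (Q * |k|) * |z - z'| := by
    intro x y z z'
    have h1 := hk (c x) (hcm x) y (Real.exp (-(Sig (c x))) * z) (Real.exp (-(Sig (c x))) * z')
    rw [← mul_sub, abs_mul, abs_of_pos (Real.exp_pos _)] at h1
    have h2 := hQ _ (hcm x)
    have e : G x y z - G x y z' = (2 / (σ (c x)) ^ 2) * (Real.exp (Sig (c x)) *
        (F (c x) y (Real.exp (-(Sig (c x))) * z) - F (c x) y (Real.exp (-(Sig (c x))) * z'))) := by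
      simp only [G]; ring
    rw [e, abs_mul, abs_mul, abs_of_pos (Real.exp_pos _), mul_assoc]
    refine mul_le_mul h2 ?_ (by positivity) hQ0
    calc _ ≤ Real.exp (Sig (c x)) * (k * (Real.exp (-(Sig (c x))) * |z - z'|)) :=
          mul_le_mul_of_nonneg_left h1 (Real.exp_pos _).le
      _ = k * |z - z'| * (Real.exp (Sig (c x)) * Real.exp (-(Sig (c x)))) := by ring
      _ = k * |z - z'| := by rw [← Real.exp_add]; simp
      _ ≤ _ := mul_le_mul_of_nonneg_right (le_abs_self k) (abs_nonneg _)
  have hK0 : 0 ≤ Q * |k| := by positivity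
  obtain ⟨u, v, h⟩ := full_exists (A := A) (B := B) hab hp hpc hP hK0 hGc hGm hGL
  refine ⟨u, ⟨h.ua, h.ub, fun x => Real.exp (-(Sig x)) * v x, v a, ?_, ?_, ?_⟩, ?_⟩
  · have := h.cv
    fun_prop
  · intro x hx
    beta_reduce; rw [← hpe x hx]
    exact h.du x hx
  · intro x hx
    have e := ftc1 (fun t ht => by simpa using h.dv t ht) (comp3 hGc h.cu h.cv) x hx
    have e2 : ∫ y in a..x, G y (u y) (v y) = 2 * ∫ y in a..x,
        Real.exp (Sig y) * F y (u y) (Real.exp (-(Sig y)) * v y) / (σ y) ^ 2 := by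
      rw [← intervalIntegral.integral_const_mul]
      refine intervalIntegral.integral_congr fun y hy => ?_
      rw [uIcc_of_le hx.1] at hy
      exact hGe y ⟨hy.1, hy.2.trans hx.2⟩ _ _
    rw [← e2, e]
    ring
  · rintro w ⟨wa, wb, d, x₁, hd, hw, hf⟩
    have hwc : ContinuousOn w (Icc a b) := fun x hx => (hw x hx).continuousWithinAt
    have hex : ∀ x, Real.exp (-(Sig x)) * (Real.exp (Sig x) * d x) = d x := fun x => by
      rw [← mul_assoc, ← Real.exp_add]; simp
    have s : BSol p a b A B G (fun _ => 0) w (fun x => Real.exp (Sig x) * d x) := by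
      refine ⟨wa, wb, ?_, ?_⟩
      · intro x hx
        rw [hpe x hx, hex]
        exact hw x hx
      · have hgc : ContinuousOn (fun y => Real.exp (Sig y) * F y (w y) (d y) / (σ y) ^ 2)
            (Icc a b) := by
          have h1 : ContinuousOn (fun y => F y (w y) (d y)) (Icc a b) :=
            hF.comp (f := fun y => (y, w y, d y)) (continuousOn_id.prodMk (hwc.prodMk hd))
              fun y hy => hy
          have h2 : ContinuousOn (fun y => Real.exp (Sig y)) (Icc a b) := by fun_prop
          exact (h2.mul h1).div (hσ.pow 2).continuousOn fun y _ => hσ0 y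
        have e : ∀ x ∈ Icc a b, Real.exp (Sig x) * d x =
            2 * (∫ y in a..x, Real.exp (Sig y) * F y (w y) (d y) / (σ y) ^ 2) + x₁ := by
          intro x hx
          rw [hf x hx, ← mul_assoc, ← Real.exp_add]; simp
        intro x hx
        rw [hGe x hx, hex, add_zero]
        exact (((ftc2 hab hgc x hx).const_mul 2).add_const x₁).congr e (e x hx)
    have e1 := stab hab hp hK0 hGm hGL s h (ε := 0) (fun x _ => by simp)
    have e2 := stab_u hab hP s h rfl e1
    intro x hx
    have := e2 x hx
    simp only [mul_zero, zero_mul, abs_nonpos_iff] at this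
    linarith
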